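/- arXiv:1808.04830 — 2 statements merged into one kernel-verified Lean document; each statement's English description precedes it below -/
import Mathlib

section
/- Let χ : ℝ → ℝ be an increasing homeomorphism of the real line onto itself satisfying χ(t+2π) = χ(t) + 2π for all t, and define χ_e on the upper half-plane ℍ = {x+iy : y > 0} by χ_e(x+iy) = (1/2)·∫_{−1}^{1} χ(x+ty)·(1 + 2i·sgn t) dt. Then χ_e is a diffeomorphism of ℍ onto itself and for all x ∈ ℝ, y > 0: (i) ‖Dχ_e(x+iy)‖ ≤ 2·(χ(x+y) − χ(x−y))/y; (ii) ‖Dχ_e(x+iy)⁻¹‖ ≤ 4y / min( χ(x+y) − χ(x+y/2), χ(x−y/2) − χ(x−y) ); (iii) |Im χ_e(x+iy) − y| ≤ 4π. -/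
open Complex Real MeasureTheory Set

/-- The Beurling–Ahlfors-type extension
`χₑ(x+iy) = (1/2) ∫_{−1}^{1} χ(x+ty)(1 + 2i·sgn t) dt` of `χ : ℝ → ℝ`,
viewed as a map of the complex plane. -/
noncomputable def BAext (χ : ℝ → ℝ) (z : ℂ) : ℂ :=
  (1 / 2) * ∫ t in (-1:ℝ)..1,
    (χ (z.re + t * z.im) : ℂ) * (1 + 2 * Complex.I * (Real.sign t : ℂ))

/-- The mean value of `χ` over the oriented segment from `x` to `x + y`. -/
noncomputable def segAvg (χ : ℝ → ℝ) (x y : ℝ) : ℝ :=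
  ∫ t in (0:ℝ)..1, χ (x + t * y)

section UnitInterval

theorem integral_unit_le_half_add {f : ℝ → ℝ} (hf : Continuous f) (hm : Monotone f) :
    ∫ t in (0:ℝ)..1, f t ≤ (f (1 / 2) + f 1) / 2 := by
  have hi : ∀ a b, IntervalIntegrable f volume a b := fun a b => hf.intervalIntegrable a b
  rw [← intervalIntegral.integral_add_adjacent_intervals (hi 0 (1 / 2)) (hi (1 / 2) 1)]
  have h1 : ∫ t in (0:ℝ)..(1 / 2), f t ≤ ∫ _t in (0:ℝ)..(1 / 2), f (1 / 2) :=
    intervalIntegral.integral_mono_on (by norm_num) (hi _ _) (by simp) fun t ht => hm ht.2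
  have h2 : ∫ t in (1 / 2 : ℝ)..1, f t ≤ ∫ _t in (1 / 2 : ℝ)..1, f 1 :=
    intervalIntegral.integral_mono_on (by norm_num) (hi _ _) (by simp) fun t ht => hm ht.2
  simp only [intervalIntegral.integral_const, smul_eq_mul] at h1 h2
  linarith

end UnitInterval

section SegAvg

variable {χ : ℝ → ℝ}

theorem continuous_segAvg (hcont : Continuous χ) :
    Continuous fun p : ℝ × ℝ => segAvg χ p.1 p.2 := by
  unfold segAvg
  fun_prop

theorem segAvg_zero (x : ℝ) : segAvg χ x 0 = χ x := by simp [segAvg]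

theorem segAvg_strictMono_left (hmono : StrictMono χ) (hcont : Continuous χ) (y : ℝ) :
    StrictMono fun x => segAvg χ x y := by
  intro x x' h
  refine intervalIntegral.integral_lt_integral_of_continuousOn_of_le_of_exists_lt one_pos
    (by fun_prop) (by fun_prop) (fun t _ => (hmono (by linarith)).le)
    ⟨0, by simp, hmono (by linarith)⟩

theorem segAvg_strictMono_right (hmono : StrictMono χ) (hcont : Continuous χ) (x : ℝ) :
    StrictMono fun y => segAvg χ x y := by
  intro y y' h
  refine intervalIntegral.integral_lt_integral_of_continuousOn_of_le_of_exists_lt one_pos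
    (by fun_prop) (by fun_prop) (fun t ht => hmono.monotone ?_)
    ⟨1, by simp, hmono (by linarith)⟩
  have := mul_le_mul_of_nonneg_left h.le ht.1.le
  linarith

theorem monotone_comp_segment (hmono : StrictMono χ) (x : ℝ) {y : ℝ} (hy : 0 ≤ y) :
    Monotone fun t => χ (x + t * y) := fun s t h =>
  hmono.monotone (by have := mul_le_mul_of_nonneg_right h hy; linarith)

theorem segAvg_le_half_add (hmono : StrictMono χ) (hcont : Continuous χ) (x : ℝ) {y : ℝ}
    (hy : 0 ≤ y) : segAvg χ x y ≤ (χ (x + y / 2) + χ (x + y)) / 2 := by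
  have := integral_unit_le_half_add (f := fun t => χ (x + t * y)) (by fun_prop)
    (monotone_comp_segment hmono x hy)
  simp only [one_mul, one_div_mul_eq_div] at this
  exact this

/-- Conjugating `χ` by `t ↦ -t` reverses the orientation of the averaging segment. -/
theorem segAvg_neg_comp_neg (x y : ℝ) :
    segAvg (fun t => -χ (-t)) (-x) y = -segAvg χ x (-y) := by
  unfold segAvg
  rw [← intervalIntegral.integral_neg]
  refine intervalIntegral.integral_congr fun t _ => ?_
  have : -(-x + t * y) = x + t * -y := by ring
  simp only [this]

theorem half_add_le_segAvg_neg (hmono : StrictMono χ) (hcont : Continuous χ) (x : ℝ) {y : ℝ}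
    (hy : 0 ≤ y) : (χ (x - y / 2) + χ (x - y)) / 2 ≤ segAvg χ x (-y) := by
  have h := segAvg_le_half_add (χ := fun t => -χ (-t))
    (fun a b hab => neg_lt_neg (hmono (neg_lt_neg hab))) (by fun_prop) (-x) hy
  rw [segAvg_neg_comp_neg] at h
  have e1 : -(-x + y / 2) = x - y / 2 := by ring
  have e2 : -(-x + y) = x - y := by ring
  simp only [e1, e2] at h
  linarith

theorem mul_segAvg (hcont : Continuous χ) (x y : ℝ) :
    y * segAvg χ x y = (∫ t in (0:ℝ)..(x + y), χ t) - ∫ t in (0:ℝ)..x, χ t := by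
  have h := intervalIntegral.mul_integral_comp_add_mul (a := 0) (b := 1) (f := χ) y x
  simp only [mul_zero, add_zero, mul_one] at h
  rw [intervalIntegral.integral_interval_sub_left (hcont.intervalIntegrable _ _)
    (hcont.intervalIntegrable _ _), ← h]
  simp only [segAvg, mul_comm]

/-- Partial derivatives of the mean value over a nondegenerate segment. -/
theorem hasFDerivAt_segAvg (hcont : Continuous χ) (c : ℝ) (z : ℂ) (hz : c * z.im ≠ 0) :
    HasFDerivAt (fun w : ℂ => segAvg χ w.re (c * w.im))
      (((χ (z.re + c * z.im) - χ z.re) / (c * z.im)) • reCLM +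
        (c * ((χ (z.re + c * z.im) - segAvg χ z.re (c * z.im)) / (c * z.im))) • imCLM) z := by
  have hF : ∀ u, HasDerivAt (fun v => ∫ t in (0:ℝ)..v, χ t) (χ u) u := fun u =>
    intervalIntegral.integral_hasDerivAt_right (hcont.intervalIntegrable _ _)
      hcont.stronglyMeasurable.stronglyMeasurableAtFilter hcont.continuousAt
  have hre : HasFDerivAt (fun w : ℂ => w.re) reCLM z := reCLM.hasFDerivAt
  have him : HasFDerivAt (fun w : ℂ => c * w.im) (c • imCLM) z :=
    imCLM.hasFDerivAt.const_mul c
  have h1 := (hF (z.re + c * z.im)).comp_hasFDerivAt z (hre.add him)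
  have h2 := (hF z.re).comp_hasFDerivAt z hre
  have hinv := (hasDerivAt_inv hz).comp_hasFDerivAt z him
  have h := (h1.sub h2).mul hinv
  have hne : ∀ᶠ w : ℂ in nhds z, c * w.im ≠ 0 :=
    ContinuousAt.eventually_ne (by fun_prop) hz
  have hseg := mul_segAvg hcont z.re (c * z.im)
  refine (h.congr_of_eventuallyEq ?_).congr_fderiv ?_
  · filter_upwards [hne] with w hw
    have := mul_segAvg hcont w.re (c * w.im)
    simp only [Function.comp_apply, Pi.mul_apply, Pi.sub_apply, Pi.add_apply]
    rw [← this, mul_comm (c * w.im), mul_inv_cancel_right₀ hw]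
  · ext w
    simp only [Function.comp_apply, Pi.sub_apply, Pi.add_apply, ← hseg,
      add_apply, smul_apply, sub_apply, smul_eq_mul, reCLM_apply, imCLM_apply]
    field_simp
    ring

end SegAvg

section Periodic

variable {χ : ℝ → ℝ}

/-- A monotone lift of a circle map distorts distances by at most one period. -/
theorem abs_sub_sub_sub_le (hmono : StrictMono χ)
    (hper : ∀ t : ℝ, χ (t + 2 * π) = χ t + 2 * π) (s t : ℝ) :
    |χ s - χ t - (s - t)| ≤ 2 * π := by
  have hp : Function.Periodic (fun t => χ t - t) (2 * π) := fun t => by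
    simp only [hper]; ring
  obtain ⟨u, hu, h⟩ := hp.exists_mem_Ico two_pi_pos s t
  have h1 := hmono.monotone hu.1
  have h2 := hmono.monotone hu.2.le
  rw [hper] at h2
  rw [abs_le]
  constructor <;> linarith [hu.1, hu.2]

theorem abs_segAvg_sub_segAvg_neg_sub_le (hmono : StrictMono χ) (hcont : Continuous χ)
    (hper : ∀ t : ℝ, χ (t + 2 * π) = χ t + 2 * π) (x y : ℝ) :
    |segAvg χ x y - segAvg χ x (-y) - y| ≤ 2 * π := by
  have hy : ∫ t in (0:ℝ)..1, 2 * y * t = y := by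
    rw [intervalIntegral.integral_const_mul, integral_id]; ring
  have e : segAvg χ x y - segAvg χ x (-y) - y =
      ∫ t in (0:ℝ)..1, (χ (x + t * y) - χ (x + t * -y) - 2 * y * t) := by
    rw [intervalIntegral.integral_sub, intervalIntegral.integral_sub, hy, segAvg, segAvg]
    all_goals exact Continuous.intervalIntegrable (by fun_prop) _ _
  have h := intervalIntegral.norm_integral_le_of_norm_le_const (a := 0) (b := 1) (C := 2 * π)
    (f := fun t => χ (x + t * y) - χ (x + t * -y) - 2 * y * t) fun t _ => by
      have := abs_sub_sub_sub_le hmono hper (x + t * y) (x + t * -y)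
      rwa [show x + t * y - (x + t * -y) = 2 * y * t by ring] at this
  rw [e]
  simpa using h

end Periodic

section RealLinear

/-- The real-linear map of `ℂ` with matrix `!![p, q; r, s]` in the basis `1, I`. -/
noncomputable def planeCLM (p q r s : ℝ) : ℂ →L[ℝ] ℂ :=
  (p • reCLM + q • imCLM).smulRight (1 : ℂ) + (r • reCLM + s • imCLM).smulRight I

theorem planeCLM_re (p q r s : ℝ) (w : ℂ) :
    (planeCLM p q r s w).re = p * w.re + q * w.im := by
  simp [planeCLM]

theorem planeCLM_im (p q r s : ℝ) (w : ℂ) :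
    (planeCLM p q r s w).im = r * w.re + s * w.im := by
  simp [planeCLM]

/-- The operator norm is bounded by the Hilbert–Schmidt norm. -/
theorem norm_planeCLM_le {p q r s C : ℝ} (hC : 0 ≤ C)
    (h : p ^ 2 + q ^ 2 + r ^ 2 + s ^ 2 ≤ C ^ 2) : ‖planeCLM p q r s‖ ≤ C := by
  refine ContinuousLinearMap.opNorm_le_bound _ hC fun w => ?_
  refine le_of_sq_le_sq ?_ (by positivity)
  rw [mul_pow, ← normSq_eq_norm_sq, ← normSq_eq_norm_sq, normSq_apply, normSq_apply,
    planeCLM_re, planeCLM_im]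
  nlinarith [sq_nonneg (p * w.im - q * w.re), sq_nonneg (r * w.im - s * w.re),
    mul_le_mul_of_nonneg_right h (add_nonneg (mul_self_nonneg w.re) (mul_self_nonneg w.im))]

theorem planeCLM_comp_adjugate {p q r s : ℝ} (h : p * s - q * r ≠ 0) (w : ℂ) :
    planeCLM (s / (p * s - q * r)) (-q / (p * s - q * r)) (-r / (p * s - q * r))
      (p / (p * s - q * r)) (planeCLM p q r s w) = w := by
  generalize hd : p * s - q * r = d at h ⊢
  apply Complex.ext <;> simp only [planeCLM_re, planeCLM_im] <;> field_simp <;> rw [← hd] <;> ring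

theorem planeCLM_adjugate_comp {p q r s : ℝ} (h : p * s - q * r ≠ 0) (w : ℂ) :
    planeCLM p q r s (planeCLM (s / (p * s - q * r)) (-q / (p * s - q * r))
      (-r / (p * s - q * r)) (p / (p * s - q * r)) w) = w := by
  generalize hd : p * s - q * r = d at h ⊢
  apply Complex.ext <;> simp only [planeCLM_re, planeCLM_im] <;> field_simp <;> rw [← hd] <;> ring

/-- `planeCLM` as an equivalence when the determinant does not vanish. -/
noncomputable def planeCLE (p q r s : ℝ) (h : p * s - q * r ≠ 0) : ℂ ≃L[ℝ] ℂ :=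
  ContinuousLinearEquiv.equivOfInverse (planeCLM p q r s)
    (planeCLM (s / (p * s - q * r)) (-q / (p * s - q * r)) (-r / (p * s - q * r))
      (p / (p * s - q * r)))
    (planeCLM_comp_adjugate h) (planeCLM_adjugate_comp h)

theorem norm_planeCLE_symm_le {p q r s C : ℝ} (h : 0 < p * s - q * r) (hC : 0 ≤ C)
    (hb : p ^ 2 + q ^ 2 + r ^ 2 + s ^ 2 ≤ (C * (p * s - q * r)) ^ 2) :
    ‖((planeCLE p q r s h.ne').symm : ℂ →L[ℝ] ℂ)‖ ≤ C := by
  refine norm_planeCLM_le hC ?_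
  simp only [div_pow, ← add_div, neg_sq]
  rw [div_le_iff₀ (by positivity), ← mul_pow]
  linarith

end RealLinear

section Extension

variable {χ : ℝ → ℝ}

theorem BAext_eq (hcont : Continuous χ) (z : ℂ) :
    BAext χ z = (((segAvg χ z.re z.im + segAvg χ z.re (-z.im)) / 2 : ℝ) : ℂ) +
      ((segAvg χ z.re z.im - segAvg χ z.re (-z.im) : ℝ) : ℂ) * I := by
  set f : ℝ → ℂ := fun t => (χ (z.re + t * z.im) : ℂ) * (1 + 2 * I * (Real.sign t : ℂ)) with hf
  have hpos : EqOn (fun t : ℝ => (χ (z.re + t * z.im) : ℂ) * (1 + 2 * I)) f (uIoo 0 1) := by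
    intro t ht
    rw [uIoo_of_le zero_le_one] at ht
    simp [hf, Real.sign_of_pos ht.1]
  have hneg : EqOn (fun t : ℝ => (χ (z.re + t * z.im) : ℂ) * (1 - 2 * I)) f (uIoo (-1) 0) := by
    intro t ht
    rw [uIoo_of_le (by norm_num)] at ht
    simp [hf, Real.sign_of_neg ht.2, sub_eq_add_neg]
  have hcpos : IntervalIntegrable (fun t : ℝ => (χ (z.re + t * z.im) : ℂ) * (1 + 2 * I))
      volume 0 1 := Continuous.intervalIntegrable (by fun_prop) _ _
  have hcneg : IntervalIntegrable (fun t : ℝ => (χ (z.re + t * z.im) : ℂ) * (1 - 2 * I))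
      volume (-1) 0 := Continuous.intervalIntegrable (by fun_prop) _ _
  have hflip : ∫ t in (-1:ℝ)..0, χ (z.re + t * z.im) = segAvg χ z.re (-z.im) := by
    have h := intervalIntegral.integral_comp_neg (a := 0) (b := 1)
      (fun t => χ (z.re + t * z.im))
    rw [neg_zero] at h
    rw [← h, segAvg]
    simp only [neg_mul, mul_neg]
  have hsum : ∫ t in (-1:ℝ)..1, f t = (segAvg χ z.re (-z.im) : ℂ) * (1 - 2 * I) +
      (segAvg χ z.re z.im : ℂ) * (1 + 2 * I) := by
    rw [← intervalIntegral.integral_add_adjacent_intervals (hcneg.congr_uIoo hneg)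
      (hcpos.congr_uIoo hpos), ← intervalIntegral.integral_congr_uIoo hneg,
      ← intervalIntegral.integral_congr_uIoo hpos, intervalIntegral.integral_mul_const,
      intervalIntegral.integral_mul_const, intervalIntegral.integral_ofReal,
      intervalIntegral.integral_ofReal, hflip, segAvg, segAvg]
  rw [BAext, hsum]
  push_cast
  ring

theorem BAext_re (hcont : Continuous χ) (z : ℂ) :
    (BAext χ z).re = (segAvg χ z.re z.im + segAvg χ z.re (-z.im)) / 2 := by
  simp only [BAext_eq hcont, add_re, re_ofReal_mul, ofReal_re, I_re, mul_zero, add_zero]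

theorem BAext_im (hcont : Continuous χ) (z : ℂ) :
    (BAext χ z).im = segAvg χ z.re z.im - segAvg χ z.re (-z.im) := by
  simp only [BAext_eq hcont, add_im, im_ofReal_mul, ofReal_im, I_im, mul_one, zero_add]

theorem hasFDerivAt_BAext (hcont : Continuous χ) {z : ℂ} (hz : z.im ≠ 0) {A B A' B' : ℝ}
    (hA : A = (χ (z.re + z.im) - χ z.re) / z.im)
    (hB : B = (χ (z.re + z.im) - segAvg χ z.re z.im) / z.im)
    (hA' : A' = (χ z.re - χ (z.re - z.im)) / z.im)
    (hB' : B' = (segAvg χ z.re (-z.im) - χ (z.re - z.im)) / z.im) :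
    HasFDerivAt (BAext χ)
      (planeCLM ((A + A') / 2) ((B - B') / 2) (A - A') (B + B')) z := by
  have h1 := hasFDerivAt_segAvg hcont 1 z (by simpa using hz)
  have h2 := hasFDerivAt_segAvg hcont (-1) z (by simpa using hz)
  have hu := (((h1.add h2).const_mul (1 / 2)).smul_const (1 : ℂ))
  have hv := (h1.sub h2).smul_const I
  refine ((hu.add hv).congr_of_eventuallyEq (Filter.Eventually.of_forall fun w => ?_)).congr_fderiv
    ?_
  · simp only [BAext_eq hcont, Pi.add_apply, Pi.sub_apply, one_mul, neg_one_mul, real_smul]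
    push_cast; ring
  · ext w
    subst hA hB hA' hB'
    simp [planeCLM, ← sub_eq_add_neg]
    field_simp
    ring

theorem exists_fderiv_BAext_bounds (hmono : StrictMono χ) (hcont : Continuous χ) {z : ℂ}
    (hz : 0 < z.im) :
    ∃ D : ℂ ≃L[ℝ] ℂ, HasFDerivAt (BAext χ) (D : ℂ →L[ℝ] ℂ) z ∧
      ‖(D : ℂ →L[ℝ] ℂ)‖ ≤ 2 * (χ (z.re + z.im) - χ (z.re - z.im)) / z.im ∧
      ‖(D.symm : ℂ →L[ℝ] ℂ)‖ ≤ 4 * z.im /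
        min (χ (z.re + z.im) - χ (z.re + z.im / 2))
            (χ (z.re - z.im / 2) - χ (z.re - z.im)) := by
  set x := z.re with hx
  set y := z.im with hy
  obtain ⟨A, hA⟩ : ∃ A, A = (χ (x + y) - χ x) / y := ⟨_, rfl⟩
  obtain ⟨B, hB⟩ : ∃ B, B = (χ (x + y) - segAvg χ x y) / y := ⟨_, rfl⟩
  obtain ⟨A', hA'⟩ : ∃ A', A' = (χ x - χ (x - y)) / y := ⟨_, rfl⟩
  obtain ⟨B', hB'⟩ : ∃ B', B' = (segAvg χ x (-y) - χ (x - y)) / y := ⟨_, rfl⟩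
  obtain ⟨m, hm⟩ : ∃ m, m = min (χ (x + y) - χ (x + y / 2)) (χ (x - y / 2) - χ (x - y)) :=
    ⟨_, rfl⟩
  have hmpos : 0 < m := by
    rw [hm]
    exact lt_min (sub_pos.2 (hmono (by linarith))) (sub_pos.2 (hmono (by linarith)))
  have hr := segAvg_strictMono_right hmono hcont x
  have hBA : B ≤ A := by
    rw [hA, hB]
    have := hr hz
    simp only [segAvg_zero] at this
    gcongr
  have hBA' : B' ≤ A' := by
    rw [hA', hB']
    have := hr (neg_lt_zero.2 hz)
    simp only [segAvg_zero] at this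
    gcongr
  have hmB : m / (2 * y) ≤ B := by
    have h1 := segAvg_le_half_add hmono hcont x hz.le
    have h2 : m ≤ χ (x + y) - χ (x + y / 2) := hm ▸ min_le_left _ _
    rw [hB, div_le_div_iff₀ (by positivity) hz]
    nlinarith
  have hmB' : m / (2 * y) ≤ B' := by
    have h1 := half_add_le_segAvg_neg hmono hcont x hz.le
    have h2 : m ≤ χ (x - y / 2) - χ (x - y) := hm ▸ min_le_right _ _
    rw [hB', div_le_div_iff₀ (by positivity) hz]
    nlinarith
  have hk : 0 < m / (2 * y) := by positivity
  have hS : (χ (x + y) - χ (x - y)) / y = A + A' := by rw [hA, hA']; ring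
  have hJ : (A + A') / 2 * (B + B') - (B - B') / 2 * (A - A') = A * B' + A' * B := by ring
  have hJpos : 0 < (A + A') / 2 * (B + B') - (B - B') / 2 * (A - A') := by
    rw [hJ]
    have : 0 < A * B' := mul_pos (by linarith) (by linarith)
    have : 0 < A' * B := mul_pos (by linarith) (by linarith)
    linarith
  have hHS : ((A + A') / 2) ^ 2 + ((B - B') / 2) ^ 2 + (A - A') ^ 2 + (B + B') ^ 2 ≤
      (2 * (A + A')) ^ 2 := by
    have h1 : (B - B') ^ 2 ≤ (A + A') ^ 2 := by
      apply sq_le_sq' <;> linarith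
    have h2 : (A - A') ^ 2 ≤ (A + A') ^ 2 := by
      apply sq_le_sq' <;> linarith
    have h3 : (B + B') ^ 2 ≤ (A + A') ^ 2 := by
      apply sq_le_sq' <;> linarith
    nlinarith [sq_nonneg (A + A')]
  refine ⟨planeCLE _ _ _ _ hJpos.ne', hasFDerivAt_BAext hcont hz.ne' hA hB hA' hB', ?_, ?_⟩
  · rw [mul_div_assoc, hS]
    exact norm_planeCLM_le (by linarith) hHS
  · rw [← hm]
    refine norm_planeCLE_symm_le hJpos (by positivity) (hHS.trans ?_)
    refine pow_le_pow_left₀ (by linarith) ?_ 2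
    rw [hJ]
    have h1 : m / (2 * y) * (A + A') ≤ A * B' + A' * B := by
      nlinarith [mul_le_mul_of_nonneg_left hmB' (by linarith : 0 ≤ A),
        mul_le_mul_of_nonneg_left hmB (by linarith : 0 ≤ A')]
    calc 2 * (A + A') = 4 * y / m * (m / (2 * y) * (A + A')) := by field_simp; ring
      _ ≤ _ := by gcongr

theorem BAext_injOn (hmono : StrictMono χ) (hcont : Continuous χ) :
    InjOn (BAext χ) {z : ℂ | 0 < z.im} := by
  have key : ∀ z w : ℂ, BAext χ z = BAext χ w → ¬ z.re < w.re := by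
    intro z w h hlt
    have hre := congrArg re h
    have him := congrArg im h
    rw [BAext_re hcont, BAext_re hcont] at hre
    rw [BAext_im hcont, BAext_im hcont] at him
    have h1 := segAvg_strictMono_left hmono hcont w.im hlt
    have h2 := segAvg_strictMono_left hmono hcont (-w.im) hlt
    have h3 : w.im < z.im := (segAvg_strictMono_right hmono hcont z.re).lt_iff_lt.1
      (by simp only at h1 ⊢; linarith)
    have h4 : -w.im < -z.im := (segAvg_strictMono_right hmono hcont z.re).lt_iff_lt.1
      (by simp only at h2 ⊢; linarith)
    linarith
  intro z _ w _ h
  have hx : z.re = w.re := le_antisymm (not_lt.1 (key w z h.symm)) (not_lt.1 (key z w h))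
  have hre := congrArg re h
  have him := congrArg im h
  rw [BAext_re hcont, BAext_re hcont] at hre
  rw [BAext_im hcont, BAext_im hcont] at him
  refine Complex.ext hx ((segAvg_strictMono_right hmono hcont z.re).injective ?_)
  simp only [hx] at hre him ⊢
  linarith

/-- Every pair `β < α` is the pair of mean values of `χ` over the two halves of a segment:
a highest point of the region where the right mean is at most `α` and the left mean is at
least `β` realises both. -/
theorem exists_segAvg_eq (hmono : StrictMono χ) (hcont : Continuous χ)
    (hsurj : Function.Surjective χ) (hper : ∀ t : ℝ, χ (t + 2 * π) = χ t + 2 * π)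
    {α β : ℝ} (h : β < α) :
    ∃ x y : ℝ, 0 < y ∧ segAvg χ x y = α ∧ segAvg χ x (-y) = β := by
  obtain ⟨a, rfl⟩ := hsurj α
  obtain ⟨b, rfl⟩ := hsurj β
  have hc1 := continuous_segAvg hcont
  have hc2 : Continuous fun p : ℝ × ℝ => segAvg χ p.1 (-p.2) :=
    hc1.comp (continuous_fst.prodMk continuous_snd.neg)
  have hL := segAvg_strictMono_left hmono hcont
  have hR := segAvg_strictMono_right hmono hcont
  set K : Set (ℝ × ℝ) :=
    {p | 0 ≤ p.2 ∧ segAvg χ p.1 p.2 ≤ χ a ∧ χ b ≤ segAvg χ p.1 (-p.2)} with hK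
  have hclosed : IsClosed K :=
    (isClosed_le continuous_const continuous_snd).inter
      ((isClosed_le hc1 continuous_const).inter (isClosed_le continuous_const hc2))
  have hsub : K ⊆ Icc b a ×ˢ Icc 0 (χ a - χ b + 2 * π) := by
    rintro ⟨x, y⟩ ⟨hy, h1, h2⟩
    simp only at hy h1 h2
    have h3 := (hR x).monotone hy
    have h4 := (hR x).monotone (neg_nonpos.2 hy)
    simp only [segAvg_zero] at h3 h4
    have h5 := (abs_le.1 (abs_segAvg_sub_segAvg_neg_sub_le hmono hcont hper x y)).1
    exact ⟨⟨hmono.le_iff_le.1 (h2.trans h4), hmono.le_iff_le.1 (h3.trans h1)⟩, hy, by linarith⟩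
  have hcompact : IsCompact K := (isCompact_Icc.prod isCompact_Icc).of_isClosed_subset hclosed hsub
  have hne : K.Nonempty := ⟨(a, 0), le_rfl, by simp [segAvg_zero], by simpa [segAvg_zero] using h.le⟩
  obtain ⟨⟨x, y⟩, ⟨hy, h1, h2⟩, hmax⟩ := hcompact.exists_isMaxOn hne continuous_snd.continuousOn
  simp only at hy h1 h2
  have hstrict : ∀ u, segAvg χ u y < χ a → χ b < segAvg χ u (-y) → False := by
    intro u hu1 hu2
    have e1 : ∀ᶠ v in nhdsWithin y (Ioi y), segAvg χ u v < χ a :=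
      (ContinuousAt.eventually_lt (f := fun v => segAvg χ u v)
        (hc1.comp (Continuous.prodMk_right u)).continuousAt continuousAt_const hu1).filter_mono
        nhdsWithin_le_nhds
    have e2 : ∀ᶠ v in nhdsWithin y (Ioi y), χ b < segAvg χ u (-v) :=
      (ContinuousAt.eventually_lt (g := fun v => segAvg χ u (-v)) continuousAt_const
        (hc2.comp (Continuous.prodMk_right u)).continuousAt hu2).filter_mono
        nhdsWithin_le_nhds
    obtain ⟨v, hv1, hv2, hv3⟩ := (e1.and (e2.and self_mem_nhdsWithin)).exists
    have hv3 : y < v := hv3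
    have : v ≤ y := hmax (show (u, v) ∈ K from ⟨hy.trans hv3.le, hv1.le, hv2.le⟩)
    linarith
  have h1' : segAvg χ x y = χ a := by
    by_contra hne1
    have hlt := lt_of_le_of_ne h1 hne1
    have e1 : ∀ᶠ u in nhdsWithin x (Ioi x), segAvg χ u y < χ a :=
      (ContinuousAt.eventually_lt (f := fun u => segAvg χ u y)
        (hc1.comp (Continuous.prodMk_left y)).continuousAt continuousAt_const hlt).filter_mono
        nhdsWithin_le_nhds
    obtain ⟨u, hu1, hu2⟩ := (e1.and self_mem_nhdsWithin).exists
    exact hstrict u hu1 (h2.trans_lt (hL (-y) hu2))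
  have h2' : segAvg χ x (-y) = χ b := by
    by_contra hne2
    have hlt := lt_of_le_of_ne h2 (Ne.symm hne2)
    have e1 : ∀ᶠ u in nhdsWithin x (Iio x), χ b < segAvg χ u (-y) :=
      (ContinuousAt.eventually_lt (g := fun u => segAvg χ u (-y)) continuousAt_const
        (hc2.comp (Continuous.prodMk_left y)).continuousAt hlt).filter_mono
        nhdsWithin_le_nhds
    obtain ⟨u, hu1, hu2⟩ := (e1.and self_mem_nhdsWithin).exists
    exact hstrict u ((hL y hu2).trans_le h1) hu1
  refine ⟨x, y, lt_of_le_of_ne hy ?_, h1', h2'⟩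
  rintro rfl
  rw [neg_zero] at h2'
  exact h.ne (h2'.symm.trans h1')

theorem BAext_bijOn (hmono : StrictMono χ) (hcont : Continuous χ)
    (hsurj : Function.Surjective χ) (hper : ∀ t : ℝ, χ (t + 2 * π) = χ t + 2 * π) :
    BijOn (BAext χ) {z : ℂ | 0 < z.im} {z : ℂ | 0 < z.im} := by
  refine ⟨fun z hz => ?_, BAext_injOn hmono hcont, fun w hw => ?_⟩
  · have hz : 0 < z.im := hz
    change 0 < (BAext χ z).im
    rw [BAext_im hcont, sub_pos]
    exact segAvg_strictMono_right hmono hcont z.re (by linarith)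
  · have hw : 0 < w.im := hw
    obtain ⟨x, y, hy, h1, h2⟩ := exists_segAvg_eq hmono hcont hsurj hper
      (α := w.re + w.im / 2) (β := w.re - w.im / 2) (by linarith)
    refine ⟨⟨x, y⟩, hy, Complex.ext ?_ ?_⟩
    · rw [BAext_re hcont, h1, h2]; ring
    · rw [BAext_im hcont, h1, h2]; ring

end Extension

/-- **Beurling–Ahlfors extension bounds.** If `χ : ℝ → ℝ` is an increasing
homeomorphism of the line with `χ(t+2π) = χ(t)+2π`, then `χₑ` is a diffeomorphism of
the upper half-plane `ℍ` onto itself, and for `x ∈ ℝ`, `y > 0`: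
`‖Dχₑ(x+iy)‖ ≤ 2(χ(x+y)−χ(x−y))/y`,
`‖Dχₑ(x+iy)⁻¹‖ ≤ 4y / min(χ(x+y)−χ(x+y/2), χ(x−y/2)−χ(x−y))`, and
`|Im χₑ(x+iy) − y| ≤ 4π`. -/
theorem BAext_diffeo_bounds (χ : ℝ → ℝ) (hmono : StrictMono χ)
    (hcont : Continuous χ) (hsurj : Function.Surjective χ)
    (hper : ∀ t : ℝ, χ (t + 2 * π) = χ t + 2 * π) :
    BijOn (BAext χ) {z : ℂ | 0 < z.im} {z : ℂ | 0 < z.im} ∧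
    ∀ z : ℂ, 0 < z.im →
      (∃ D : ℂ ≃L[ℝ] ℂ, HasFDerivAt (BAext χ) (D : ℂ →L[ℝ] ℂ) z ∧
        ‖(D : ℂ →L[ℝ] ℂ)‖ ≤ 2 * (χ (z.re + z.im) - χ (z.re - z.im)) / z.im ∧
        ‖(D.symm : ℂ →L[ℝ] ℂ)‖ ≤ 4 * z.im /
          min (χ (z.re + z.im) - χ (z.re + z.im / 2))
              (χ (z.re - z.im / 2) - χ (z.re - z.im))) ∧
      |(BAext χ z).im - z.im| ≤ 4 * π := by
  refine ⟨BAext_bijOn hmono hcont hsurj hper, fun z hz =>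
    ⟨exists_fderiv_BAext_bounds hmono hcont hz, ?_⟩⟩
  rw [BAext_im hcont]
  have h := abs_segAvg_sub_segAvg_neg_sub_le hmono hcont hper z.re z.im
  linarith [pi_pos]
end

section
/- For every constant c > 0 there exist L < ∞ and an embedding f : 𝕋 → ℂ satisfying (1/2)·|a−b| ≤ |f(a)−f(b)| ≤ L·|a−b| for all a, b ∈ 𝕋, such that no homeomorphism F : ℂ → ℂ extending f satisfies |F(a)−F(b)| ≥ c·|a−b| for all a, b ∈ ℂ. Consequently, the lower bound in the planar extension estimate cannot have the form c·ℓ·|a−b| with a universal constant c > 0 (nor any positive factor depending on ℓ alone). -/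
open Complex Metric Set

/-! ### Polar coordinates -/

theorem norm_exp_I_mul_sub_exp_I_mul (x y : ℝ) :
    ‖exp (I * x) - exp (I * y)‖ = 2 * |Real.sin ((x - y) / 2)| := by
  have h : exp (I * x) - exp (I * y) = exp (I * y) * (exp (I * (x - y : ℝ)) - 1) := by
    rw [mul_sub, ← exp_add]
    push_cast
    ring_nf
  rw [h, norm_mul, norm_exp_I_mul_ofReal, norm_exp_I_mul_ofReal_sub_one]
  simp

theorem norm_exp_I_mul_sub_exp_I_mul_le (x y : ℝ) :
    ‖exp (I * x) - exp (I * y)‖ ≤ |x - y| := by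
  rw [norm_exp_I_mul_sub_exp_I_mul]
  have := Real.abs_sin_le_abs (x := (x - y) / 2)
  rw [abs_div, abs_two] at this
  linarith

theorem abs_sub_le_norm_polar_sub_polar {r s : ℝ} (hr : 0 ≤ r) (hs : 0 ≤ s) (x y : ℝ) :
    |r - s| ≤ ‖(r : ℂ) * exp (I * x) - s * exp (I * y)‖ := by
  simpa [norm_exp_I_mul_ofReal, abs_of_nonneg hr, abs_of_nonneg hs] using
    abs_norm_sub_norm_le ((r : ℂ) * exp (I * x)) (s * exp (I * y))

/-- The radial projection of the exterior of the unit disc onto the circle does not increase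
distances. -/
theorem norm_exp_sub_exp_le_norm_polar_sub_polar {r s : ℝ} (hr : 1 ≤ r) (hs : 1 ≤ s) (x y : ℝ) :
    ‖exp (I * x) - exp (I * y)‖ ≤ ‖(r : ℂ) * exp (I * x) - s * exp (I * y)‖ := by
  have key : ∀ r s : ℝ, ‖(r : ℂ) * exp (I * x) - s * exp (I * y)‖ ^ 2 =
      (r - s) ^ 2 + 2 * (r * s) * (1 - Real.cos (x - y)) := by
    intro r s
    rw [← normSq_eq_norm_sq, normSq_apply, mul_comm I, mul_comm I, exp_mul_I, exp_mul_I,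
      ← ofReal_cos, ← ofReal_sin, ← ofReal_cos, ← ofReal_sin, Real.cos_sub]
    simp only [sub_re, sub_im, mul_re, mul_im, add_re, add_im, ofReal_re, ofReal_im, I_re, I_im]
    linear_combination r ^ 2 * Real.sin_sq_add_cos_sq x + s ^ 2 * Real.sin_sq_add_cos_sq y
  have h1 := key 1 1
  simp only [ofReal_one, one_mul] at h1
  refine le_of_sq_le_sq ?_ (norm_nonneg _)
  rw [h1, key r s]
  have hrs : 1 ≤ r * s := by nlinarith
  nlinarith [sq_nonneg (r - s), Real.cos_le_one (x - y)]

theorem norm_polar_sub_polar_le (r : ℝ) {s : ℝ} (hs : 0 ≤ s) (x y : ℝ) :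
    ‖(r : ℂ) * exp (I * x) - s * exp (I * y)‖ ≤ |r - s| + s * |x - y| := by
  have h : (r : ℂ) * exp (I * x) - s * exp (I * y) =
      (r - s : ℝ) * exp (I * x) + s * (exp (I * x) - exp (I * y)) := by
    push_cast
    ring
  rw [h]
  refine (norm_add_le _ _).trans (add_le_add ?_ ?_)
  · rw [norm_mul, norm_real, norm_exp_I_mul_ofReal, mul_one, Real.norm_eq_abs]
  · rw [norm_mul, norm_real, Real.norm_of_nonneg hs]
    exact mul_le_mul_of_nonneg_left (norm_exp_I_mul_sub_exp_I_mul_le x y) hs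

theorem exp_I_mul_arg {z : ℂ} (hz : z ∈ sphere (0 : ℂ) 1) : exp (I * (arg z : ℝ)) = z := by
  have h := norm_mul_exp_arg_mul_I z
  rwa [mem_sphere_zero_iff_norm.mp hz, ofReal_one, one_mul, mul_comm] at h

theorem exp_I_mul_mem_sphere (x : ℝ) : exp (I * x) ∈ sphere (0 : ℂ) 1 := by
  simp [norm_exp_I_mul_ofReal]

/-! ### Two bounds for the sine beyond a right angle -/

theorem two_div_pi_mul_sub_le_sin {x : ℝ} (h1 : Real.pi / 2 ≤ x) (h2 : x ≤ Real.pi) :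
    2 / Real.pi * (Real.pi - x) ≤ Real.sin x := by
  rw [← Real.sin_pi_sub]
  exact Real.mul_le_sin (by linarith) (by linarith)

theorem two_div_three_pi_mul_le_sin {x : ℝ} (h0 : 0 ≤ x) (h1 : x ≤ 3 * Real.pi / 4) :
    2 / (3 * Real.pi) * x ≤ Real.sin x := by
  have hpi := Real.pi_pos
  have e : 2 / (3 * Real.pi) * x = 2 / Real.pi * (x / 3) := by field_simp
  have hc : 0 ≤ 2 / Real.pi := by positivity
  rw [e]
  rcases le_total x (Real.pi / 2) with h | h
  · exact (mul_le_mul_of_nonneg_left (by linarith) hc).trans (Real.mul_le_sin h0 h)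
  · exact (mul_le_mul_of_nonneg_left (by linarith) hc).trans
      (two_div_pi_mul_sub_le_sin h (by linarith))

/-! ### The keyhole curve -/

/-- The truncation of `θ / δ` to `[-1, 1]`. -/
noncomputable def keyholeParam (δ θ : ℝ) : ℝ := max (-1) (min 1 (θ / δ))

/-- The polar angle of the keyhole curve at parameter `θ`. -/
noncomputable def keyholeAngle (δ θ : ℝ) : ℝ := θ + Real.pi - Real.pi * keyholeParam δ θ

/-- The distance from the origin of the keyhole curve at parameter `θ`. -/
noncomputable def keyholeRadius (δ θ : ℝ) : ℝ := 1 + Real.pi * (1 - |keyholeParam δ θ|)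

/-- The keyhole curve: it fixes the points of the unit circle with `δ ≤ |arg z|`, and sends the
remaining short arc around the unit disc, on its outside, the long way round. -/
noncomputable def keyhole (δ : ℝ) (z : ℂ) : ℂ :=
  keyholeRadius δ (arg z) * exp (I * keyholeAngle δ (arg z))

theorem abs_keyholeParam_le_one (δ θ : ℝ) : |keyholeParam δ θ| ≤ 1 :=
  abs_le.mpr ⟨le_max_left _ _, max_le (by norm_num) (min_le_left _ _)⟩

theorem keyholeParam_of_abs_le {δ θ : ℝ} (hδ : 0 < δ) (h : |θ| ≤ δ) :
    keyholeParam δ θ = θ / δ := by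
  obtain ⟨h1, h2⟩ := abs_le.mp h
  rw [keyholeParam, min_eq_right ((div_le_one hδ).mpr h2), max_eq_right]
  rw [le_div_iff₀ hδ]
  linarith

theorem keyholeParam_of_le {δ θ : ℝ} (hδ : 0 < δ) (h : δ ≤ θ) : keyholeParam δ θ = 1 := by
  rw [keyholeParam, min_eq_left ((one_le_div hδ).mpr h), max_eq_right (by norm_num)]

theorem keyholeParam_of_le_neg {δ θ : ℝ} (hδ : 0 < δ) (h : θ ≤ -δ) : keyholeParam δ θ = -1 := by
  have h' : θ / δ ≤ -1 := by
    rw [div_le_iff₀ hδ]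
    linarith
  rw [keyholeParam, min_eq_right (by linarith), max_eq_left h']

theorem abs_keyholeParam_of_le_abs {δ θ : ℝ} (hδ : 0 < δ) (h : δ ≤ |θ|) :
    |keyholeParam δ θ| = 1 := by
  rcases le_abs'.mp h with h | h
  · simp [keyholeParam_of_le_neg hδ h]
  · simp [keyholeParam_of_le hδ h]

theorem abs_keyholeParam_sub_le {δ : ℝ} (hδ : 0 < δ) (x y : ℝ) :
    |keyholeParam δ x - keyholeParam δ y| ≤ |x - y| / δ := by
  calc |keyholeParam δ x - keyholeParam δ y| ≤ |min 1 (x / δ) - min 1 (y / δ)| := by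
        simpa [keyholeParam] using abs_max_sub_max_le_max (-1) (min 1 (x / δ)) (-1) (min 1 (y / δ))
    _ ≤ |x / δ - y / δ| := by
        simpa using abs_min_sub_min_le_max 1 (x / δ) 1 (y / δ)
    _ = |x - y| / δ := by rw [← sub_div, abs_div, abs_of_pos hδ]

theorem one_le_keyholeRadius (δ θ : ℝ) : 1 ≤ keyholeRadius δ θ := by
  have := abs_keyholeParam_le_one δ θ
  have := mul_nonneg Real.pi_pos.le (sub_nonneg.mpr this)
  rw [keyholeRadius]
  linarith

theorem keyholeAngle_mem_Ioo {δ θ : ℝ} (hδ : 0 < δ) (hδ1 : δ ≤ 1) (h1 : -Real.pi < θ)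
    (h2 : θ ≤ Real.pi) : keyholeAngle δ θ ∈ Ioo 0 (2 * Real.pi) := by
  have hpi := Real.pi_gt_three
  rw [keyholeAngle]
  rcases le_total |θ| δ with h | h
  · rw [keyholeParam_of_abs_le hδ h]
    obtain ⟨h3, h4⟩ := abs_le.mp h
    have e : θ + Real.pi - Real.pi * (θ / δ) = Real.pi + θ / δ * (δ - Real.pi) := by
      field_simp
      ring
    have h5 : θ / δ ≤ 1 := (div_le_one hδ).mpr h4
    have h6 : -1 ≤ θ / δ := by
      rw [le_div_iff₀ hδ]
      linarith
    rw [e]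
    constructor <;> nlinarith
  · rcases le_abs'.mp h with h | h
    · rw [keyholeParam_of_le_neg hδ h]
      constructor <;> linarith
    · rw [keyholeParam_of_le hδ h]
      constructor <;> linarith

theorem exp_I_mul_keyholeAngle (δ θ : ℝ) :
    exp (I * keyholeAngle δ θ) * exp (I * (Real.pi * keyholeParam δ θ : ℝ)) =
      -exp (I * θ) := by
  rw [← exp_add, keyholeAngle]
  push_cast
  rw [show I * (θ + Real.pi - Real.pi * keyholeParam δ θ) + I * (Real.pi * keyholeParam δ θ) =
    I * θ + Real.pi * I by ring, exp_add, exp_pi_mul_I]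
  ring

theorem exp_I_mul_pi_mul_of_abs_eq_one {t : ℝ} (ht : |t| = 1) :
    exp (I * (Real.pi * t : ℝ)) = -1 := by
  rcases (abs_eq zero_le_one).mp ht with rfl | rfl
  · rw [mul_one, mul_comm, exp_pi_mul_I]
  · rw [mul_comm]
    simp [exp_neg, exp_pi_mul_I]

theorem keyhole_of_le_abs_arg {δ : ℝ} (hδ : 0 < δ) {z : ℂ} (hz : z ∈ sphere (0 : ℂ) 1)
    (h : δ ≤ |arg z|) : keyhole δ z = z := by
  have ht := abs_keyholeParam_of_le_abs hδ h
  have h1 := exp_I_mul_keyholeAngle δ (arg z)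
  rw [exp_I_mul_pi_mul_of_abs_eq_one ht, exp_I_mul_arg hz] at h1
  have h2 : exp (I * keyholeAngle δ (arg z)) = z := by linear_combination -h1
  rw [keyhole, h2, keyholeRadius, ht]
  simp

theorem one_le_norm_keyhole (δ : ℝ) (z : ℂ) : 1 ≤ ‖keyhole δ z‖ := by
  have h := one_le_keyholeRadius δ (arg z)
  rwa [keyhole, norm_mul, norm_exp_I_mul_ofReal, norm_real,
    Real.norm_of_nonneg (zero_le_one.trans h), mul_one]

theorem keyhole_ne_ofReal {δ : ℝ} (hδ : 0 < δ) (hδ1 : δ ≤ 1) (z : ℂ) {x : ℝ} (hx : 0 ≤ x) :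
    keyhole δ z ≠ x := by
  intro h
  have hr := one_le_keyholeRadius δ (arg z)
  obtain ⟨h1, h2⟩ := keyholeAngle_mem_Ioo hδ hδ1 (neg_pi_lt_arg z) (arg_le_pi z)
  have hxr : keyholeRadius δ (arg z) = x := by
    have := congrArg norm h
    rwa [keyhole, norm_mul, norm_exp_I_mul_ofReal, norm_real, norm_real,
      Real.norm_of_nonneg (zero_le_one.trans hr), Real.norm_of_nonneg hx, mul_one] at this
  have hne : (x : ℂ) ≠ 0 := by
    rw [← hxr]
    exact_mod_cast (zero_lt_one.trans_le hr).ne'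
  rw [keyhole, hxr] at h
  have he : exp (I * keyholeAngle δ (arg z)) = 1 := mul_left_cancel₀ hne (by rw [h, mul_one])
  have hs := norm_exp_I_mul_sub_exp_I_mul (keyholeAngle δ (arg z)) 0
  have hpos := Real.sin_pos_of_pos_of_lt_pi (x := (keyholeAngle δ (arg z) - 0) / 2)
    (by linarith) (by linarith)
  rw [he, abs_of_pos hpos] at hs
  simp at hs hpos
  linarith

/-! ### Bi-Lipschitz bounds for the keyhole curve -/

theorem norm_one_add_exp_I_mul_pi_mul_le {t : ℝ} (ht : |t| ≤ 1) :
    ‖1 + exp (I * (Real.pi * t : ℝ))‖ ≤ Real.pi * (1 - |t|) := by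
  obtain ⟨s, hs, hst⟩ : ∃ s : ℝ, |s| = 1 ∧ |t - s| = 1 - |t| := by
    obtain ⟨h1, h2⟩ := abs_le.mp ht
    rcases le_total 0 t with h | h
    · exact ⟨1, abs_one, by rw [abs_of_nonneg h, abs_of_nonpos (by linarith)]; ring⟩
    · exact ⟨-1, by simp, by rw [abs_of_nonpos h, abs_of_nonneg (by linarith)]; ring⟩
  have h := norm_exp_I_mul_sub_exp_I_mul_le (Real.pi * t) (Real.pi * s)
  rwa [exp_I_mul_pi_mul_of_abs_eq_one hs, sub_neg_eq_add, add_comm, ← mul_sub, abs_mul,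
    abs_of_pos Real.pi_pos, hst] at h

theorem half_dist_le_dist_keyhole_of_le_abs_arg {δ : ℝ} (hδ : 0 < δ) {a b : ℂ}
    (ha : a ∈ sphere (0 : ℂ) 1) (hb : b ∈ sphere (0 : ℂ) 1) (h : δ ≤ |arg a|) :
    1 / 2 * dist a b ≤ dist (keyhole δ a) (keyhole δ b) := by
  have hra := keyhole_of_le_abs_arg hδ ha h
  have hrb := one_le_keyholeRadius δ (arg b)
  have hp := exp_I_mul_keyholeAngle δ (arg b)
  rw [exp_I_mul_arg hb] at hp
  have hq := norm_one_add_exp_I_mul_pi_mul_le (abs_keyholeParam_le_one δ (arg b))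
  have hrad := abs_sub_le_norm_polar_sub_polar zero_le_one (zero_le_one.trans hrb)
    (arg a) (keyholeAngle δ (arg b))
  have hang := norm_exp_sub_exp_le_norm_polar_sub_polar le_rfl hrb
    (arg a) (keyholeAngle δ (arg b))
  rw [exp_I_mul_arg ha, ofReal_one, one_mul] at hrad hang
  rw [hra, dist_eq, dist_eq, keyhole]
  set w := exp (I * keyholeAngle δ (arg b))
  set v := exp (I * (Real.pi * keyholeParam δ (arg b) : ℝ))
  have hw : ‖w‖ = 1 := norm_exp_I_mul_ofReal _
  have htri : ‖a - b‖ ≤ ‖a - w‖ + ‖1 + v‖ := by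
    have e : a - b = (a - w) + w * (1 + v) := by linear_combination -hp
    rw [e]
    exact (norm_add_le _ _).trans (by rw [norm_mul, hw, one_mul])
  have hR : |1 - keyholeRadius δ (arg b)| = Real.pi * (1 - |keyholeParam δ (arg b)|) := by
    rw [abs_of_nonpos (by linarith), keyholeRadius]
    ring
  linarith

theorem half_dist_le_dist_keyhole_of_abs_arg_le {δ : ℝ} (hδ : 0 < δ) (hδ1 : δ ≤ 1) {a b : ℂ}
    (ha : a ∈ sphere (0 : ℂ) 1) (hb : b ∈ sphere (0 : ℂ) 1) (hxa : |arg a| ≤ δ)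
    (hxb : |arg b| ≤ δ) :
    1 / 2 * dist a b ≤ dist (keyhole δ a) (keyhole δ b) := by
  have hpi := Real.pi_gt_three
  have hpi4 := Real.pi_le_four
  have hang := norm_exp_sub_exp_le_norm_polar_sub_polar (one_le_keyholeRadius δ (arg a))
    (one_le_keyholeRadius δ (arg b)) (keyholeAngle δ (arg a)) (keyholeAngle δ (arg b))
  have hab := norm_exp_I_mul_sub_exp_I_mul_le (arg a) (arg b)
  rw [exp_I_mul_arg ha, exp_I_mul_arg hb] at hab
  rw [dist_eq, dist_eq, keyhole, keyhole]
  refine le_trans ?_ hang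
  rw [norm_exp_I_mul_sub_exp_I_mul]
  set d := |arg a - arg b| with hd
  have hd0 : 0 ≤ d := abs_nonneg _
  have hd2 : d ≤ 2 * δ := by
    have := abs_sub (arg a) (arg b)
    linarith
  set u := d * (Real.pi - δ) / (2 * δ) with hu
  have e : |Real.sin ((keyholeAngle δ (arg a) - keyholeAngle δ (arg b)) / 2)| =
      |Real.sin u| := by
    have e1 : (keyholeAngle δ (arg a) - keyholeAngle δ (arg b)) / 2 =
        -((arg a - arg b) * (Real.pi - δ) / (2 * δ)) := by
      rw [keyholeAngle, keyholeAngle, keyholeParam_of_abs_le hδ hxa,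
        keyholeParam_of_abs_le hδ hxb]
      field_simp
      ring
    rw [e1, Real.sin_neg, abs_neg, hu, hd]
    rcases abs_choice (arg a - arg b) with h | h
    · rw [h]
    · rw [h, neg_mul, neg_div, Real.sin_neg, abs_neg]
  have hu0 : 0 ≤ u := by
    have : 0 ≤ Real.pi - δ := by linarith
    positivity
  have hu1 : u ≤ Real.pi - δ := by
    rw [hu, div_le_iff₀ (by positivity)]
    nlinarith
  have hdu : d ≤ u := by
    rw [hu, le_div_iff₀ (by positivity)]
    nlinarith
  have hc : 1 / 2 ≤ 2 / Real.pi := by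
    rw [div_le_div_iff₀ (by norm_num) (by linarith)]
    linarith
  rw [e]
  have hsin := le_abs_self (Real.sin u)
  rcases le_total u (Real.pi / 2) with h | h
  · have := Real.mul_le_sin hu0 h
    nlinarith
  · have := two_div_pi_mul_sub_le_sin h (by linarith)
    nlinarith

theorem half_dist_le_dist_keyhole {δ : ℝ} (hδ : 0 < δ) (hδ1 : δ ≤ 1) {a b : ℂ}
    (ha : a ∈ sphere (0 : ℂ) 1) (hb : b ∈ sphere (0 : ℂ) 1) :
    1 / 2 * dist a b ≤ dist (keyhole δ a) (keyhole δ b) := by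
  rcases le_total δ |arg a| with h | h
  · exact half_dist_le_dist_keyhole_of_le_abs_arg hδ ha hb h
  rcases le_total δ |arg b| with h' | h'
  · rw [dist_comm a, dist_comm (keyhole δ a)]
    exact half_dist_le_dist_keyhole_of_le_abs_arg hδ hb ha h'
  · exact half_dist_le_dist_keyhole_of_abs_arg_le hδ hδ1 ha hb h h'

theorem dist_keyhole_le_abs_arg_sub {δ : ℝ} (hδ : 0 < δ) (a b : ℂ) :
    dist (keyhole δ a) (keyhole δ b) ≤
      (Real.pi / δ + (1 + Real.pi) * (1 + Real.pi / δ)) * |arg a - arg b| := by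
  have hpi := Real.pi_pos
  have hτ := abs_keyholeParam_sub_le hδ (arg a) (arg b)
  have hr := one_le_keyholeRadius δ (arg b)
  have hr' : keyholeRadius δ (arg b) ≤ 1 + Real.pi := by
    rw [keyholeRadius]
    nlinarith [abs_nonneg (keyholeParam δ (arg b))]
  have hτ' : Real.pi * |keyholeParam δ (arg a) - keyholeParam δ (arg b)| ≤
      Real.pi / δ * |arg a - arg b| := by
    calc _ ≤ Real.pi * (|arg a - arg b| / δ) := by gcongr
      _ = _ := by ring
  have h1 : |keyholeRadius δ (arg a) - keyholeRadius δ (arg b)| ≤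
      Real.pi / δ * |arg a - arg b| := by
    refine le_trans ?_ hτ'
    rw [keyholeRadius, keyholeRadius, show ∀ s t : ℝ, 1 + Real.pi * (1 - s) -
      (1 + Real.pi * (1 - t)) = Real.pi * (t - s) by intros; ring, abs_mul, abs_of_pos hpi,
      abs_sub_comm (keyholeParam δ (arg a))]
    exact mul_le_mul_of_nonneg_left (abs_abs_sub_abs_le _ _) hpi.le
  have h2 : |keyholeAngle δ (arg a) - keyholeAngle δ (arg b)| ≤
      (1 + Real.pi / δ) * |arg a - arg b| := by
    rw [keyholeAngle, keyholeAngle, show ∀ x y s t : ℝ, x + Real.pi - Real.pi * s -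
      (y + Real.pi - Real.pi * t) = (x - y) - Real.pi * (s - t) by intros; ring]
    refine (abs_sub (arg a - arg b) _).trans ?_
    rw [abs_mul, abs_of_pos hpi]
    linarith
  rw [dist_eq, keyhole, keyhole]
  refine (norm_polar_sub_polar_le _ (zero_le_one.trans hr) _ _).trans ?_
  have h3 : keyholeRadius δ (arg b) * |keyholeAngle δ (arg a) - keyholeAngle δ (arg b)| ≤
      (1 + Real.pi) * ((1 + Real.pi / δ) * |arg a - arg b|) := by
    gcongr
  linarith

theorem abs_arg_sub_le_dist {δ : ℝ} (hδ1 : δ ≤ 1) {a b : ℂ}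
    (ha : a ∈ sphere (0 : ℂ) 1) (hb : b ∈ sphere (0 : ℂ) 1) (h : |arg a| ≤ δ) :
    |arg a - arg b| ≤ 3 * Real.pi / 2 * dist a b := by
  have hpi := Real.pi_gt_three
  have hab := norm_exp_I_mul_sub_exp_I_mul (arg a) (arg b)
  rw [exp_I_mul_arg ha, exp_I_mul_arg hb] at hab
  have hd := abs_sub (arg a) (arg b)
  have hb' := abs_arg_le_pi b
  have hsin := two_div_three_pi_mul_le_sin (x := |arg a - arg b| / 2) (by positivity)
    (by linarith)
  have hle : Real.sin (|arg a - arg b| / 2) ≤ |Real.sin ((arg a - arg b) / 2)| := by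
    rcases abs_choice (arg a - arg b) with h | h
    · rw [h]
      exact le_abs_self _
    · rw [h, neg_div, Real.sin_neg]
      exact neg_le_abs _
  have h3 : 2 / (3 * Real.pi) * |arg a - arg b| ≤ dist a b := by
    rw [dist_eq, hab]
    linarith
  calc |arg a - arg b| = 3 * Real.pi / 2 * (2 / (3 * Real.pi) * |arg a - arg b|) := by
        field_simp
    _ ≤ _ := by gcongr

theorem exists_dist_keyhole_le {δ : ℝ} (hδ : 0 < δ) (hδ1 : δ ≤ 1) :
    ∃ L : ℝ, 0 ≤ L ∧ ∀ a ∈ sphere (0 : ℂ) 1, ∀ b ∈ sphere (0 : ℂ) 1,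
      dist (keyhole δ a) (keyhole δ b) ≤ L * dist a b := by
  have hpi := Real.pi_pos
  set C := Real.pi / δ + (1 + Real.pi) * (1 + Real.pi / δ)
  have hC : 0 ≤ C := by positivity
  have aux : ∀ a ∈ sphere (0 : ℂ) 1, ∀ b ∈ sphere (0 : ℂ) 1, |arg a| ≤ δ →
      dist (keyhole δ a) (keyhole δ b) ≤ (1 + C * (3 * Real.pi / 2)) * dist a b := by
    intro a ha b hb h
    calc _ ≤ C * |arg a - arg b| := dist_keyhole_le_abs_arg_sub hδ a b
      _ ≤ C * (3 * Real.pi / 2 * dist a b) := by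
        gcongr
        exact abs_arg_sub_le_dist hδ1 ha hb h
      _ ≤ _ := by linarith [dist_nonneg (x := a) (y := b)]
  refine ⟨1 + C * (3 * Real.pi / 2), by positivity, fun a ha b hb => ?_⟩
  rcases le_total |arg a| δ with h | h
  · exact aux a ha b hb h
  rcases le_total |arg b| δ with h' | h'
  · rw [dist_comm (keyhole δ a), dist_comm a]
    exact aux b hb a ha h'
  · rw [keyhole_of_le_abs_arg hδ ha h, keyhole_of_le_abs_arg hδ hb h']
    exact le_mul_of_one_le_left dist_nonneg (by linarith [mul_nonneg hC hpi.le])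

/-! ### The topological obstruction -/

/-- Two continuous logarithms of the same function differ by a constant. -/
theorem sub_eq_sub_of_exp_eq_exp {X : Type*} [TopologicalSpace X] {s : Set X}
    (hs : IsPreconnected s) {k l : X → ℂ} (hk : ContinuousOn k s) (hl : ContinuousOn l s)
    (h : ∀ x ∈ s, exp (k x) = exp (l x)) {x y : X} (hx : x ∈ s) (hy : y ∈ s) :
    k x - l x = k y - l y := by
  refine hs.constant_of_mapsTo
    (T := (AddSubgroup.zmultiples (2 * Real.pi * I : ℂ) : Set ℂ))
    ⟨NormedSpace.discreteTopology_zmultiples _⟩ (hk.sub hl) (fun z hz => ?_) hx hy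
  obtain ⟨n, hn⟩ := exp_eq_exp_iff_exists_int.mp (h z hz)
  exact AddSubgroup.mem_zmultiples_iff.mpr ⟨n, by rw [Pi.sub_apply, hn, zsmul_eq_mul]; ring⟩

theorem exists_continuous_log_on_closedBall {G : ℂ → ℂ} (hG : Continuous G)
    (h0 : ∀ z ∈ closedBall (0 : ℂ) 1, G z ≠ 0) :
    ∃ k : ℂ → ℂ, Continuous k ∧ ∀ z ∈ closedBall (0 : ℂ) 1, exp (k z) = G z := by
  have hpos : ∀ z : ℂ, (0 : ℝ) < max 1 ‖z‖ := fun z => zero_lt_one.trans_le (le_max_left _ _)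
  have hc : Continuous fun z : ℂ => G (z / (max 1 ‖z‖ : ℝ)) := by
    refine hG.comp (continuous_id.div (by fun_prop) fun z => ?_)
    exact_mod_cast (hpos z).ne'
  have hmem : ∀ z : ℂ, z / (max 1 ‖z‖ : ℝ) ∈ closedBall (0 : ℂ) 1 := by
    intro z
    rw [mem_closedBall_zero_iff, norm_div, norm_real, Real.norm_of_nonneg (hpos z).le,
      div_le_one (hpos z)]
    exact le_max_right _ _
  have hsc : IsSimplyConnected (univ : Set ℂ) := by
    have := (convex_univ (𝕜 := ℝ) (E := ℂ)).contractibleSpace univ_nonempty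
    exact SimplyConnectedSpace.ofContractible _
  obtain ⟨k, hk, hkG⟩ := exists_continuousOn_eqOn_exp_comp hsc isOpen_univ
    hc.continuousOn (by
      rintro ⟨z, -, hz⟩
      exact h0 _ (hmem z) hz)
  refine ⟨k, continuousOn_univ.mp hk, fun z hz => ?_⟩
  have h := hkG (mem_univ z)
  rw [mem_closedBall_zero_iff] at hz
  simpa [max_eq_left hz] using h

/-- A nonvanishing continuous function on the disc cannot be the identity on an arc of the
circle and take the complementary arc into the disc of radius `1` around `1`. -/
theorem exists_eq_zero_of_eqOn_arc {G : ℂ → ℂ} (hG : Continuous G) {δ : ℝ} (hδ : 0 < δ)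
    (hδ1 : δ ≤ 1)
    (hid : ∀ θ : ℝ, δ ≤ θ → θ ≤ 2 * Real.pi - δ → G (exp (I * θ)) = exp (I * θ))
    (hnear : ∀ θ : ℝ, |θ| ≤ δ → ‖G (exp (I * θ)) - 1‖ < 1) :
    ∃ z ∈ closedBall (0 : ℂ) 1, G z = 0 := by
  by_contra! h0
  have hpi := Real.pi_gt_three
  obtain ⟨k, hk, hkG⟩ := exists_continuous_log_on_closedBall hG h0
  have hexp : Continuous fun θ : ℝ => exp (I * θ) := by fun_prop
  have hkθ : ∀ θ : ℝ, exp (k (exp (I * θ))) = G (exp (I * θ)) := fun θ =>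
    hkG _ (sphere_subset_closedBall (exp_I_mul_mem_sphere θ))
  have hshift : exp (I * (2 * Real.pi - δ : ℝ)) = exp (I * (-δ : ℝ)) := by
    rw [show I * ((2 * Real.pi - δ : ℝ) : ℂ) = I * (-δ : ℝ) + 2 * Real.pi * I by
      push_cast; ring, exp_add, exp_two_pi_mul_I, mul_one]
  have hlong := sub_eq_sub_of_exp_eq_exp (s := Icc δ (2 * Real.pi - δ)) isPreconnected_Icc
    (k := fun θ : ℝ => k (exp (I * θ))) (l := fun θ : ℝ => I * θ)
    (hk.comp hexp).continuousOn (by fun_prop)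
    (fun θ hθ => by rw [hkθ, hid θ hθ.1 hθ.2])
    (x := δ) (y := 2 * Real.pi - δ) ⟨le_rfl, by linarith⟩ ⟨by linarith, le_rfl⟩
  have hslit : ∀ θ ∈ Icc (-δ) δ, G (exp (I * (θ : ℝ))) ∈ slitPlane := by
    intro θ hθ
    refine ball_one_subset_slitPlane ?_
    rw [mem_ball, dist_eq]
    exact hnear θ (abs_le.mpr hθ)
  have hshort := sub_eq_sub_of_exp_eq_exp (s := Icc (-δ) δ) isPreconnected_Icc
    (k := fun θ : ℝ => k (exp (I * θ))) (l := fun θ : ℝ => log (G (exp (I * θ))))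
    (hk.comp hexp).continuousOn ((hG.comp hexp).continuousOn.clog hslit)
    (fun θ hθ => by rw [hkθ, exp_log (slitPlane_ne_zero (hslit θ hθ))])
    (x := δ) (y := -δ) ⟨by linarith, le_rfl⟩ ⟨le_rfl, by linarith⟩
  have hG1 : G (exp (I * δ)) = exp (I * δ) := hid δ le_rfl (by linarith)
  have hG2 : G (exp (I * (-δ : ℝ))) = exp (I * (-δ : ℝ)) := by
    rw [← hshift]
    exact hid _ (by linarith) le_rfl
  have hlog : ∀ θ : ℝ, |θ| ≤ δ → log (exp (I * θ)) = I * θ := by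
    intro θ hθ
    obtain ⟨h1, h2⟩ := abs_le.mp hθ
    exact log_exp (by simp; linarith) (by simp; linarith)
  simp only [hG1, hG2] at hshort
  rw [hlog δ (abs_of_pos hδ).le, hlog (-δ) (by rw [abs_neg, abs_of_pos hδ])] at hshort
  simp only [hshift] at hlong
  have hfinal : I * (2 * Real.pi : ℝ) = 0 := by
    push_cast at hlong hshort ⊢
    linear_combination hlong - hshort
  have := Real.pi_pos.ne'
  simp_all

/-- A homeomorphism carrying a set to the unit circle sends the unit disc to the exterior of the
open unit disc, provided the disc and a ray from it avoid the set. -/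
theorem one_le_norm_symm_of_mem_closedBall {F : ℂ ≃ₜ ℂ}
    (hball : ∀ z ∈ sphere (0 : ℂ) 1, 1 ≤ ‖F z‖)
    (hray : ∀ z ∈ sphere (0 : ℂ) 1, ∀ x : ℝ, 0 ≤ x → F z ≠ x) {w : ℂ}
    (hw : w ∈ closedBall (0 : ℂ) 1) : 1 ≤ ‖F.symm w‖ := by
  have hcont : Continuous fun w => ‖F.symm w‖ := F.symm.continuous.norm
  suffices h : ∀ w ∈ ball (0 : ℂ) 1, 1 ≤ ‖F.symm w‖ by
    rw [← closure_ball (0 : ℂ) one_ne_zero] at hw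
    exact closure_minimal h (isClosed_le continuous_const hcont) hw
  intro w hw
  by_contra! hlt
  set ray : Set ℂ := (fun x : ℝ => (x : ℂ)) '' Ici 0
  have hS : IsPreconnected (ball (0 : ℂ) 1 ∪ ray) :=
    (convex_ball (0 : ℂ) 1).isPreconnected.union 0 (mem_ball_self zero_lt_one)
      ⟨0, self_mem_Ici, ofReal_zero⟩
      (isPreconnected_Ici.image _ continuous_ofReal.continuousOn)
  have havoid : ∀ v ∈ ball (0 : ℂ) 1 ∪ ray, ‖F.symm v‖ ≠ 1 := by
    intro v hv h1
    have hmem : F.symm v ∈ sphere (0 : ℂ) 1 := by simpa using h1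
    rcases hv with hv | ⟨x, hx, rfl⟩
    · have := hball _ hmem
      rw [F.apply_symm_apply] at this
      rw [mem_ball_zero_iff] at hv
      linarith
    · exact hray _ hmem x hx (F.apply_symm_apply _)
  have hinside : ∀ v ∈ ball (0 : ℂ) 1 ∪ ray, ‖F.symm v‖ < 1 := by
    intro v hv
    by_contra! hge
    obtain ⟨u, hu, hu1⟩ := hS.intermediate_value (Or.inl hw) hv hcont.continuousOn
      ⟨hlt.le, hge⟩
    exact havoid u hu hu1
  obtain ⟨M, hM⟩ := ((isCompact_closedBall (0 : ℂ) 1).image F.continuous).isBounded.exists_norm_le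
  have hx : (0 : ℝ) ≤ |M| + 1 := by positivity
  have hmem : ((|M| + 1 : ℝ) : ℂ) ∈ F '' closedBall (0 : ℂ) 1 :=
    ⟨F.symm (|M| + 1 : ℝ), by simpa using (hinside _ (Or.inr ⟨_, hx, rfl⟩)).le,
      F.apply_symm_apply _⟩
  have := hM _ hmem
  rw [norm_real, Real.norm_of_nonneg hx] at this
  linarith [le_abs_self M]

theorem not_lower_bound_of_eqOn_keyhole {c δ : ℝ} (hc : 0 < c) (hδ : 0 < δ) (hδ1 : δ ≤ 1)
    (hδc : 2 * δ < c * (1 - δ)) {F : ℂ ≃ₜ ℂ} (hF : EqOn F (keyhole δ) (sphere (0 : ℂ) 1)) :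
    ¬ ∀ a b : ℂ, c * dist a b ≤ dist (F a) (F b) := by
  intro hlow
  have hpi := Real.pi_gt_three
  have hid : ∀ θ : ℝ, δ ≤ θ → θ ≤ 2 * Real.pi - δ →
      F.symm (exp (I * θ)) = exp (I * θ) := by
    intro θ h1 h2
    have hmem := exp_I_mul_mem_sphere θ
    have harg : δ ≤ |arg (exp (I * θ))| := by
      rw [mul_comm]
      rcases le_or_gt θ Real.pi with h | h
      · rw [arg_exp_mul_I, (toIocMod_eq_self _).mpr ⟨by linarith, by linarith⟩]
        exact h1.trans (le_abs_self _)
      · rw [show (θ : ℂ) * I = ((θ - 2 * Real.pi : ℝ) : ℂ) * I + 2 * Real.pi * I by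
          push_cast; ring, exp_add, exp_two_pi_mul_I, mul_one, arg_exp_mul_I,
          (toIocMod_eq_self _).mpr ⟨by linarith, by linarith⟩]
        exact le_trans (by linarith) (neg_le_abs _)
    rw [F.symm_apply_eq, hF hmem, keyhole_of_le_abs_arg hδ hmem harg]
  obtain ⟨z, hz, hz0⟩ := exists_eq_zero_of_eqOn_arc F.symm.continuous hδ hδ1 hid (by
    intro θ hθ
    obtain ⟨h1, h2⟩ := abs_le.mp hθ
    have hGδ := hid δ le_rfl (by linarith)
    have h3 := hlow (F.symm (exp (I * θ))) (F.symm (exp (I * δ)))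
    rw [F.apply_symm_apply, F.apply_symm_apply, hGδ, dist_eq, dist_eq] at h3
    have h4 := norm_exp_I_mul_sub_exp_I_mul_le θ δ
    have h5 : |θ - δ| ≤ 2 * δ := abs_le.mpr ⟨by linarith, by linarith⟩
    have h6 : ‖F.symm (exp (I * θ)) - exp (I * δ)‖ < 1 - δ :=
      lt_of_mul_lt_mul_left (by linarith) hc.le
    have h7 := Real.norm_exp_I_mul_ofReal_sub_one_le (x := δ)
    rw [Real.norm_of_nonneg hδ.le] at h7
    linarith [norm_sub_le_norm_sub_add_norm_sub (F.symm (exp (I * θ))) (exp (I * δ)) 1])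
  have h1 := one_le_norm_symm_of_mem_closedBall (F := F)
    (fun v hv => by rw [hF hv]; exact one_le_norm_keyhole δ v)
    (fun v hv x hx => by rw [hF hv]; exact keyhole_ne_ofReal hδ hδ1 v hx) hz
  rw [hz0, norm_zero] at h1
  linarith

/-- **Example 5.1 (keyhole).** For every `c > 0` there are `L < ∞` and an embedding
`f : 𝕋 → ℂ` with `(1/2)|a−b| ≤ |f a − f b| ≤ L|a−b|` on the circle, such that no
homeomorphic extension `F : ℂ → ℂ` of `f` satisfies `|F a − F b| ≥ c|a−b|` on all of `ℂ`.
Hence the lower bound in the planar extension estimate cannot be of the form `c·ℓ·|a−b|`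
with a universal `c > 0`. -/
theorem no_linear_lower_bound_for_planar_extension :
    ∀ c : ℝ, 0 < c → ∃ (L : ℝ) (f : ℂ → ℂ),
      ContinuousOn f (sphere (0:ℂ) 1) ∧ InjOn f (sphere (0:ℂ) 1) ∧
      (∀ a ∈ sphere (0:ℂ) 1, ∀ b ∈ sphere (0:ℂ) 1,
        (1 / 2) * dist a b ≤ dist (f a) (f b) ∧ dist (f a) (f b) ≤ L * dist a b) ∧
      ∀ F : ℂ ≃ₜ ℂ, EqOn F f (sphere (0:ℂ) 1) →
        ¬ (∀ a b : ℂ, c * dist a b ≤ dist (F a) (F b)) := by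
  intro c hc
  have hδ : 0 < c / (c + 3) := by positivity
  have hδ1 : c / (c + 3) ≤ 1 := (div_le_one (by positivity)).mpr (by linarith)
  have hδc : 2 * (c / (c + 3)) < c * (1 - c / (c + 3)) := by
    rw [show c * (1 - c / (c + 3)) = 3 * (c / (c + 3)) by field_simp; ring]
    linarith
  obtain ⟨L, hL, hLip⟩ := exists_dist_keyhole_le hδ hδ1
  refine ⟨L, keyhole (c / (c + 3)), ?_, ?_,
    fun a ha b hb => ⟨half_dist_le_dist_keyhole hδ hδ1 ha hb, hLip a ha b hb⟩,
    fun F hF => not_lower_bound_of_eqOn_keyhole hc hδ hδ1 hδc hF⟩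
  · exact (LipschitzOnWith.of_dist_le_mul (K := ⟨L, hL⟩) hLip).continuousOn
  · intro a ha b hb hab
    have h := half_dist_le_dist_keyhole hδ hδ1 ha hb
    rw [hab, dist_self] at h
    exact dist_le_zero.mp (by linarith)
end
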